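/- arXiv:0907.4684 — 3 statements merged into one kernel-verified Lean document; each statement's English description precedes it below -/
import Mathlib

section
/- For an ergodic dynamical system (X, T, μ), the return time generalized dimensions D_τ^+(q) and D_τ^-(q) are monotone non-increasing functions of the index q. -/
open MeasureTheory Filter Set
open scoped ENNReal Topology NNReal

noncomputable section

/-- First return time of `x` to the set `A` under the map `T`;
by convention it is `0` if the orbit of `x` never returns to `A`. -/
def firstReturn {α : Type*} (T : α → α) (A : Set α) (x : α) : ℕ :=
  sInf {k : ℕ | 0 < k ∧ T^[k] x ∈ A}

/-- Extended logarithm `ℝ≥0∞ → EReal`. -/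
def elog (x : ℝ≥0∞) : EReal :=
  if x = 0 then ⊥ else if x = ⊤ then ⊤ else ((Real.log x.toReal : ℝ) : EReal)

section Generic

variable {α : Type*} [MeasurableSpace α] [PseudoMetricSpace α]

/-- The measure partition function `Γ_μ(ε,q)`. -/
def measPF (μ : Measure α) (ε q : ℝ) : ℝ≥0∞ :=
  ∫⁻ x, μ (Metric.ball x ε) ^ (q - 1) ∂μ

/-- The logarithmic measure partition function `Γ^l_μ(ε)`. -/
def measPFlog (μ : Measure α) (ε : ℝ) : ℝ :=
  ∫ x, Real.log (μ (Metric.ball x ε)).toReal ∂μ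

/-- The return time partition function `Γ_τ(ε,q)`. -/
def retPF (T : α → α) (μ : Measure α) (ε q : ℝ) : ℝ≥0∞ :=
  ∫⁻ x, (firstReturn T (Metric.ball x ε) x : ℝ≥0∞) ^ (1 - q) ∂μ

/-- The logarithmic return time partition function `Γ^l_τ(ε)`. -/
def retPFlog (T : α → α) (μ : Measure α) (ε : ℝ) : ℝ :=
  ∫ x, Real.log ((firstReturn T (Metric.ball x ε) x : ℝ))⁻¹ ∂μ

/-- The scaling exponent `(1/(q-1)) · log F(ε) / log ε`. -/
def dimScale (F : ℝ → ℝ≥0∞) (q : ℝ) (ε : ℝ) : EReal :=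
  ((((q - 1) * Real.log ε)⁻¹ : ℝ) : EReal) * elog (F ε)

/-- Upper generalized dimension obtained from a one-parameter family of partition
functions `F ε`, with the logarithmic convention at `q = 1`. -/
def dimPlus (F : ℝ → ℝ≥0∞) (Flog : ℝ → ℝ) (q : ℝ) : EReal :=
  if q = 1 then ((limsup (fun ε => Flog ε / Real.log ε) (𝓝[>] (0:ℝ)) : ℝ) : EReal)
  else limsup (dimScale F q) (𝓝[>] (0:ℝ))

/-- Lower generalized dimension. -/
def dimMinus (F : ℝ → ℝ≥0∞) (Flog : ℝ → ℝ) (q : ℝ) : EReal :=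
  if q = 1 then ((liminf (fun ε => Flog ε / Real.log ε) (𝓝[>] (0:ℝ)) : ℝ) : EReal)
  else liminf (dimScale F q) (𝓝[>] (0:ℝ))

/-- Generalized measure dimensions `D_μ^+(q)`. -/
def DmuPlus (μ : Measure α) (q : ℝ) : EReal :=
  dimPlus (fun ε => measPF μ ε q) (measPFlog μ) q

/-- Generalized measure dimensions `D_μ^-(q)`. -/
def DmuMinus (μ : Measure α) (q : ℝ) : EReal :=
  dimMinus (fun ε => measPF μ ε q) (measPFlog μ) q

/-- Return time generalized dimensions `D_τ^+(q)`. -/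
def DtauPlus (T : α → α) (μ : Measure α) (q : ℝ) : EReal :=
  dimPlus (fun ε => retPF T μ ε q) (retPFlog T μ) q

/-- Return time generalized dimensions `D_τ^-(q)`. -/
def DtauMinus (T : α → α) (μ : Measure α) (q : ℝ) : EReal :=
  dimMinus (fun ε => retPF T μ ε q) (retPFlog T μ) q

end Generic

/-- Euclidean space `ℝ^n`. -/
abbrev Euc (n : ℕ) := EuclideanSpace ℝ (Fin n)

/-- A grid in `ℝ^n` : a choice of origin and orientation, determining for every
side length `ε` a partition of `ℝ^n` into half-open cubes of side `ε`. -/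
structure Grid (n : ℕ) where
  origin : Euc n
  rot : Euc n ≃ₗᵢ[ℝ] Euc n

/-- Coordinates of a point w.r.t. a grid. -/
def Grid.coords {n : ℕ} (θ : Grid n) (x : Euc n) : Fin n → ℝ :=
  fun i => θ.rot.symm (x - θ.origin) i

/-- The cube `A_j` of side `ε` of the grid `θ`, indexed by `j : Fin n → ℤ`. -/
def Grid.box {n : ℕ} (θ : Grid n) (ε : ℝ) (j : Fin n → ℤ) : Set (Euc n) :=
  {x | ∀ i, (j i : ℝ) * ε ≤ θ.coords x i ∧ θ.coords x i < ((j i : ℝ) + 1) * ε}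

/-- The enlarged cube `Ā_j` of side `3ε` concentric with `A_j`. -/
def Grid.bigBox {n : ℕ} (θ : Grid n) (ε : ℝ) (j : Fin n → ℤ) : Set (Euc n) :=
  {x | ∀ i, ((j i : ℝ) - 1) * ε ≤ θ.coords x i ∧ θ.coords x i < ((j i : ℝ) + 2) * ε}

/-- Box measure partition function `Υ_μ(θ,ε,q) = Σ_{μ(A_j)>0} μ(A_j)^q`. -/
def boxMeasPF {n : ℕ} (μ : Measure (Euc n)) (θ : Grid n) (ε q : ℝ) : ℝ≥0∞ :=
  ∑' j : Fin n → ℤ, if μ (θ.box ε j) = 0 then 0 else μ (θ.box ε j) ^ q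

/-- Logarithmic box measure partition function `Υ^l_μ(θ,ε)`. -/
def boxMeasPFlog {n : ℕ} (μ : Measure (Euc n)) (θ : Grid n) (ε : ℝ) : ℝ :=
  ∑' j : Fin n → ℤ, (μ (θ.box ε j)).toReal * Real.log (μ (θ.box ε j)).toReal

/-- Return time box partition function `Υ_τ(θ,ε,q)`. -/
def boxRetPF {n : ℕ} (T : Euc n → Euc n) (μ : Measure (Euc n)) (θ : Grid n)
    (ε q : ℝ) : ℝ≥0∞ :=
  ∑' j : Fin n → ℤ, ∫⁻ x in θ.box ε j,
    (firstReturn T (θ.box ε j) x : ℝ≥0∞) ^ (1 - q) ∂μ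

/-- Logarithmic return time box partition function `Υ^l_τ(θ,ε)`. -/
def boxRetPFlog {n : ℕ} (T : Euc n → Euc n) (μ : Measure (Euc n)) (θ : Grid n)
    (ε : ℝ) : ℝ :=
  ∑' j : Fin n → ℤ, ∫ x in θ.box ε j,
    Real.log ((firstReturn T (θ.box ε j) x : ℝ))⁻¹ ∂μ

/-- Riedi's enhanced box partition function `Φ_μ(θ,ε,q)`. -/
def riediPF {n : ℕ} (μ : Measure (Euc n)) (θ : Grid n) (ε q : ℝ) : ℝ≥0∞ :=
  ∑' j : Fin n → ℤ, if μ (θ.box ε j) = 0 then 0 else μ (θ.bigBox ε j) ^ q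

/-- The enhanced box partition function `Ψ_μ(θ,ε,q) = Σ_{μ(A_j)>0} μ(A_j) μ(Ā_j)^{q-1}`. -/
def psiMeasPF {n : ℕ} (μ : Measure (Euc n)) (θ : Grid n) (ε q : ℝ) : ℝ≥0∞ :=
  ∑' j : Fin n → ℤ,
    if μ (θ.box ε j) = 0 then 0 else μ (θ.box ε j) * μ (θ.bigBox ε j) ^ (q - 1)

/-- The logarithmic enhanced box partition function `Ψ^l_μ(θ,ε)`. -/
def psiMeasPFlog {n : ℕ} (μ : Measure (Euc n)) (θ : Grid n) (ε : ℝ) : ℝ :=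
  ∑' j : Fin n → ℤ, (μ (θ.box ε j)).toReal * Real.log (μ (θ.bigBox ε j)).toReal

/-- The enhanced return time box partition function `Ψ_τ(θ,ε,q)`:
the integral is over `A_j` but the return is to the enlarged box `Ā_j`. -/
def psiRetPF {n : ℕ} (T : Euc n → Euc n) (μ : Measure (Euc n)) (θ : Grid n)
    (ε q : ℝ) : ℝ≥0∞ :=
  ∑' j : Fin n → ℤ, ∫⁻ x in θ.box ε j,
    (firstReturn T (θ.bigBox ε j) x : ℝ≥0∞) ^ (1 - q) ∂μ

/-- Box measure dimensions `Δ_μ^+(θ,q)`. -/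
def DeltaMuPlus {n : ℕ} (μ : Measure (Euc n)) (θ : Grid n) (q : ℝ) : EReal :=
  dimPlus (fun ε => boxMeasPF μ θ ε q) (boxMeasPFlog μ θ) q

/-- Box measure dimensions `Δ_μ^-(θ,q)`. -/
def DeltaMuMinus {n : ℕ} (μ : Measure (Euc n)) (θ : Grid n) (q : ℝ) : EReal :=
  dimMinus (fun ε => boxMeasPF μ θ ε q) (boxMeasPFlog μ θ) q

/-- Box return time dimensions `Δ_τ^+(θ,q)`. -/
def DeltaTauPlus {n : ℕ} (T : Euc n → Euc n) (μ : Measure (Euc n)) (θ : Grid n)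
    (q : ℝ) : EReal :=
  dimPlus (fun ε => boxRetPF T μ θ ε q) (boxRetPFlog T μ θ) q

/-- Box return time dimensions `Δ_τ^-(θ,q)`. -/
def DeltaTauMinus {n : ℕ} (T : Euc n → Euc n) (μ : Measure (Euc n)) (θ : Grid n)
    (q : ℝ) : EReal :=
  dimMinus (fun ε => boxRetPF T μ θ ε q) (boxRetPFlog T μ θ) q

end

namespace ReturnTime

section FirstReturn

variable {α : Type*} {T : α → α} {A : Set α} {x : α} {k : ℕ}

lemma firstReturn_le (hk : 0 < k) (h : T^[k] x ∈ A) : firstReturn T A x ≤ k :=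
  Nat.sInf_le ⟨hk, h⟩

lemma firstReturn_spec (h : ∃ k, 0 < k ∧ T^[k] x ∈ A) :
    0 < firstReturn T A x ∧ T^[firstReturn T A x] x ∈ A :=
  Nat.sInf_mem (s := {k : ℕ | 0 < k ∧ T^[k] x ∈ A}) h

lemma firstReturn_eq_iff (hk : 0 < k) :
    firstReturn T A x = k ↔ T^[k] x ∈ A ∧ ∀ j, 0 < j → j < k → T^[j] x ∉ A := by
  constructor
  · rintro rfl
    have hne : ∃ j, 0 < j ∧ T^[j] x ∈ A := Nat.nonempty_of_pos_sInf hk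
    exact ⟨(firstReturn_spec hne).2, fun j hj hlt hmem =>
      absurd (firstReturn_le hj hmem) (not_le.2 hlt)⟩
  · rintro ⟨hmem, hmin⟩
    have hspec := firstReturn_spec ⟨k, hk, hmem⟩
    refine le_antisymm (firstReturn_le hk hmem) (not_lt.1 fun hlt => ?_)
    exact hmin _ hspec.1 hlt hspec.2

lemma firstReturn_anti {B : Set α} (hAB : A ⊆ B) (h : ∃ k, 0 < k ∧ T^[k] x ∈ A) :
    firstReturn T B x ≤ firstReturn T A x :=
  firstReturn_le (firstReturn_spec h).1 (hAB (firstReturn_spec h).2)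

lemma measurable_firstReturn [MeasurableSpace α] {S : α → Set α}
    (hS : ∀ k, MeasurableSet {x | T^[k] x ∈ S x}) :
    Measurable fun x => firstReturn T (S x) x := by
  have hpos : ∀ k, 0 < k → MeasurableSet {x | firstReturn T (S x) x = k} := by
    intro k hk
    have : {x | firstReturn T (S x) x = k} =
        {x | T^[k] x ∈ S x} ∩ ⋂ j ∈ Set.Ioo 0 k, {x | T^[j] x ∈ S x}ᶜ := by
      ext x
      simp [firstReturn_eq_iff hk]
    rw [this]
    exact (hS k).inter (MeasurableSet.biInter (Set.to_countable _) fun j _ => (hS j).compl)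
  refine measurable_to_countable' fun k => ?_
  rcases Nat.eq_zero_or_pos k with rfl | hk
  · have : (fun x => firstReturn T (S x) x) ⁻¹' {0} =
        ⋂ k ∈ Set.Ioi 0, {x | firstReturn T (S x) x = k}ᶜ := by
      ext x
      simp only [mem_preimage, mem_singleton_iff, mem_iInter, mem_Ioi, mem_compl_iff,
        mem_ofPred_eq]
      exact ⟨fun h k hk => by omega, fun h => by
        by_contra hne
        exact h _ (Nat.pos_of_ne_zero hne) rfl⟩
    rw [this]
    exact MeasurableSet.biInter (Set.to_countable _) fun j hj => (hpos j hj).compl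
  · exact hpos k hk

variable [MeasurableSpace α] {μ : Measure α}

lemma ae_exists_return [IsFiniteMeasure μ] (hT : MeasurePreserving T μ μ) (hA : MeasurableSet A) :
    ∀ᵐ x ∂μ, x ∈ A → ∃ k, 0 < k ∧ T^[k] x ∈ A := by
  filter_upwards [hT.conservative.ae_mem_imp_frequently_image_mem hA.nullMeasurableSet]
    with x hx hxA
  obtain ⟨k, hk, hmem⟩ := (frequently_atTop.1 (hx hxA)) 1
  exact ⟨k, hk, hmem⟩

lemma natCast_eq_tsum (m : ℕ) : (m : ℝ≥0∞) = ∑' k : ℕ, if k < m then 1 else 0 := by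
  rw [tsum_eq_sum (s := Finset.range m) (by simp)]
  rw [Finset.sum_congr rfl (g := fun _ => 1) fun k hk => if_pos (Finset.mem_range.1 hk)]
  simp

/-- Kac's inequality. -/
lemma setLIntegral_firstReturn_le [IsProbabilityMeasure μ] (hT : MeasurePreserving T μ μ)
    (hA : MeasurableSet A) : ∫⁻ x in A, (firstReturn T A x : ℝ≥0∞) ∂μ ≤ 1 := by
  have hmeas : Measurable fun x => firstReturn T A x :=
    measurable_firstReturn (S := fun _ => A) fun k => (hT.measurable.iterate k) hA
  have hgt : ∀ k, MeasurableSet {x | k < firstReturn T A x} := fun k =>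
    measurableSet_lt measurable_const hmeas
  let B : ℕ → Set α := fun k => {x | ∀ j < k, T^[j] x ∉ A}
  have hB : ∀ k, MeasurableSet (B k) := fun k => by
    have : B k = ⋂ j ∈ Set.Iio k, (T^[j] ⁻¹' A)ᶜ := by
      ext x
      simp [B]
    rw [this]
    exact MeasurableSet.biInter (Set.to_countable _) fun j _ =>
      ((hT.measurable.iterate j) hA).compl
  have hstep : ∀ k, μ (T ⁻¹' B k ∩ A) + μ (B (k + 1)) = μ (B k) := fun k => by
    rw [← hT.measure_preimage (hB k).nullMeasurableSet, ← measure_inter_add_sdiff (T ⁻¹' B k) hA]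
    congr 2
    ext x
    simp only [B, mem_ofPred_eq, Set.mem_sdiff, mem_preimage]
    constructor
    · intro h
      exact ⟨fun j hj => h (j + 1) (by omega), h 0 (by omega)⟩
    · rintro ⟨h, h0⟩ (_ | j) hj
      · exact h0
      · exact h j (by omega)
  have hsum : ∀ N, ∑ k ∈ Finset.range N, μ (T ⁻¹' B k ∩ A) + μ (B N) = 1 := by
    intro N
    induction N with
    | zero => simp [B]
    | succ N ih => rw [Finset.sum_range_succ, add_assoc, hstep, ih]
  calc ∫⁻ x in A, (firstReturn T A x : ℝ≥0∞) ∂μ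
      = ∫⁻ x in A, ∑' k : ℕ, (if k < firstReturn T A x then 1 else 0) ∂μ := by
        simp_rw [natCast_eq_tsum]
    _ = ∑' k : ℕ, ∫⁻ x in A, (if k < firstReturn T A x then 1 else 0) ∂μ :=
        lintegral_tsum fun k => (Measurable.ite (hgt k) measurable_const
          measurable_const).aemeasurable
    _ ≤ ∑' k : ℕ, μ (T ⁻¹' B k ∩ A) := by
        refine ENNReal.tsum_le_tsum fun k => ?_
        have : (fun x => if k < firstReturn T A x then (1 : ℝ≥0∞) else 0) =
            {x | k < firstReturn T A x}.indicator 1 := by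
          ext x
          simp [Set.indicator]
        rw [this, lintegral_indicator_one (hgt k), Measure.restrict_apply (hgt k)]
        refine measure_mono (inter_subset_inter_left _ fun x hx j hj hmem => ?_)
        have : firstReturn T A x ≤ j + 1 := firstReturn_le j.succ_pos hmem
        have : k < firstReturn T A x := hx
        omega
    _ ≤ 1 := ENNReal.tsum_le_of_sum_range_le fun N => (hsum N) ▸ le_self_add

end FirstReturn

section PowerMeans

variable {Ω : Type*} [MeasurableSpace Ω] {μ : Measure Ω} [IsProbabilityMeasure μ]

lemma lintegral_rpow_le_rpow_lintegral {h : Ω → ℝ≥0∞} (hh : AEMeasurable h μ) {r : ℝ}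
    (hr0 : 0 < r) (hr1 : r ≤ 1) : ∫⁻ x, h x ^ r ∂μ ≤ (∫⁻ x, h x ∂μ) ^ r := by
  have := eLpNorm'_le_eLpNorm'_of_exponent_le (f := h) hr0 hr1 μ hh.aestronglyMeasurable
  simp only [eLpNorm', enorm_eq_self, ENNReal.rpow_one, div_one] at this
  have h2 := ENNReal.rpow_le_rpow this hr0.le
  rwa [← ENNReal.rpow_mul, one_div, inv_mul_cancel₀ hr0.ne', ENNReal.rpow_one] at h2

lemma integral_log_le_log_integral {h : Ω → ℝ} (hpos : ∀ᵐ x ∂μ, 0 < h x) (hh : Integrable h μ)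
    (hlog : Integrable (fun x => Real.log (h x)) μ) (hc : 0 < ∫ x, h x ∂μ) :
    ∫ x, Real.log (h x) ∂μ ≤ Real.log (∫ x, h x ∂μ) := by
  set c := ∫ x, h x ∂μ
  have hle : ∫ x, Real.log (h x) ∂μ ≤ ∫ x, (h x / c + (Real.log c - 1)) ∂μ := by
    refine integral_mono_ae hlog ((hh.div_const c).add (integrable_const _)) ?_
    filter_upwards [hpos] with x hx
    have := Real.log_le_sub_one_of_pos (div_pos hx hc)
    rw [Real.log_div hx.ne' hc.ne'] at this
    linarith
  rw [integral_add (hh.div_const c) (integrable_const _), integral_div, integral_const] at hle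
  simp only [probReal_univ, one_smul] at hle
  rw [show (∫ x, h x ∂μ) / c = 1 from div_self hc.ne'] at hle
  linarith

variable {f : Ω → ℕ}

lemma lintegral_natCast_rpow_ne_zero (hf : Measurable f) (hpos : ∀ᵐ x ∂μ, 0 < f x) (p : ℝ) :
    ∫⁻ x, (f x : ℝ≥0∞) ^ p ∂μ ≠ 0 := by
  have hm : Measurable fun x => (f x : ℝ≥0∞) ^ p := by fun_prop
  rw [Ne, lintegral_eq_zero_iff hm]
  intro h0
  have : ∀ᵐ _ ∂μ, False := by
    filter_upwards [h0, hpos] with x hx hx'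
    exact (ENNReal.rpow_pos (by exact_mod_cast hx') (ENNReal.natCast_ne_top _)).ne' hx
  exact IsProbabilityMeasure.ne_zero μ (by simpa using this)

lemma lintegral_natCast_rpow_le_one (hpos : ∀ᵐ x ∂μ, 0 < f x) {p : ℝ} (hp : p < 0) :
    ∫⁻ x, (f x : ℝ≥0∞) ^ p ∂μ ≤ 1 := by
  calc ∫⁻ x, (f x : ℝ≥0∞) ^ p ∂μ ≤ ∫⁻ _, 1 ∂μ := by
        refine lintegral_mono_ae ?_
        filter_upwards [hpos] with x hx
        exact ENNReal.rpow_le_one_of_one_le_of_neg (by exact_mod_cast hx) hp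
    _ = 1 := by simp

omit [IsProbabilityMeasure μ] in
lemma integrable_natCast_rpow (hf : Measurable f) {p : ℝ}
    (hfin : ∫⁻ x, (f x : ℝ≥0∞) ^ p ∂μ ≠ ⊤) :
    Integrable (fun x => (f x : ℝ) ^ p) μ ∧
      ∫ x, (f x : ℝ) ^ p ∂μ = (∫⁻ x, (f x : ℝ≥0∞) ^ p ∂μ).toReal := by
  have hm : Measurable fun x => (f x : ℝ≥0∞) ^ p := by fun_prop
  have heq : ∀ x, ((f x : ℝ≥0∞) ^ p).toReal = (f x : ℝ) ^ p := fun x => by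
    rw [← ENNReal.toReal_rpow, ENNReal.toReal_natCast]
  refine ⟨by simpa only [heq] using integrable_toReal_of_lintegral_ne_top hm.aemeasurable hfin, ?_⟩
  rw [← integral_toReal hm.aemeasurable (ae_lt_top hm hfin)]
  simp only [heq]

omit [IsProbabilityMeasure μ] in
lemma integrable_log_natCast (hf : Measurable f) (hfin : ∫⁻ x, (f x : ℝ≥0∞) ∂μ ≠ ⊤) : Integrable (fun x => Real.log (f x)) μ := by
  have hint := (integrable_natCast_rpow (p := 1) hf (by simpa using hfin)).1
  refine hint.mono'
    (Real.measurable_log.comp (measurable_from_top.comp hf)).aestronglyMeasurable (ae_of_all _ fun x => ?_)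
  rw [Real.rpow_one, Real.norm_of_nonneg (Real.log_natCast_nonneg _)]
  exact Real.log_le_self (Nat.cast_nonneg _)

lemma mul_integral_log_le (hf : Measurable f) (hpos : ∀ᵐ x ∂μ, 0 < f x)
    (hlog : Integrable (fun x => Real.log (f x)) μ) {p : ℝ}
    (hfin : ∫⁻ x, (f x : ℝ≥0∞) ^ p ∂μ ≠ ⊤) :
    p * ∫ x, Real.log (f x) ∂μ ≤ Real.log (∫⁻ x, (f x : ℝ≥0∞) ^ p ∂μ).toReal := by
  obtain ⟨hint, heq⟩ := integrable_natCast_rpow hf hfin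
  have hlogp : (fun x => Real.log ((f x : ℝ) ^ p)) =ᵐ[μ] fun x => p * Real.log (f x) := by
    filter_upwards [hpos] with x hx
    exact Real.log_rpow (by exact_mod_cast hx) p
  rw [← heq, ← integral_const_mul, ← integral_congr_ae hlogp]
  refine integral_log_le_log_integral ?_ hint ((integrable_congr hlogp).2 (hlog.const_mul p)) ?_
  · filter_upwards [hpos] with x hx
    exact Real.rpow_pos_of_pos (by exact_mod_cast hx) p
  · rw [heq]
    exact ENNReal.toReal_pos (lintegral_natCast_rpow_ne_zero hf hpos p) hfin

lemma log_lintegral_rpow_le (hf : Measurable f) (hpos : ∀ᵐ x ∂μ, 0 < f x) {p p' : ℝ}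
    (hp : p ≠ 0) (hr0 : 0 < p' / p) (hr1 : p' / p ≤ 1)
    (hfin : ∫⁻ x, (f x : ℝ≥0∞) ^ p ∂μ ≠ ⊤) :
    ∫⁻ x, (f x : ℝ≥0∞) ^ p' ∂μ ≠ ⊤ ∧ Real.log (∫⁻ x, (f x : ℝ≥0∞) ^ p' ∂μ).toReal ≤
      p' / p * Real.log (∫⁻ x, (f x : ℝ≥0∞) ^ p ∂μ).toReal := by
  have hle : ∫⁻ x, (f x : ℝ≥0∞) ^ p' ∂μ ≤ (∫⁻ x, (f x : ℝ≥0∞) ^ p ∂μ) ^ (p' / p) := by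
    have := lintegral_rpow_le_rpow_lintegral (μ := μ) (h := fun x => (f x : ℝ≥0∞) ^ p)
      (by fun_prop) hr0 hr1
    simpa only [← ENNReal.rpow_mul, mul_div_cancel₀ p' hp] using this
  have htop := ENNReal.rpow_ne_top_of_nonneg hr0.le hfin
  have hne := ne_top_of_le_ne_top htop hle
  refine ⟨hne, ?_⟩
  rw [← Real.log_rpow (ENNReal.toReal_pos (lintegral_natCast_rpow_ne_zero hf hpos p) hfin),
    ENNReal.toReal_rpow]
  exact Real.log_le_log (ENNReal.toReal_pos (lintegral_natCast_rpow_ne_zero hf hpos p') hne)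
    (ENNReal.toReal_mono htop hle)

end PowerMeans
section BallReturn

lemma lintegral_firstReturn_ball_le_card {α ι : Type*} [MeasurableSpace α] [PseudoMetricSpace α]
    {μ : Measure α} [IsProbabilityMeasure μ] {T : α → α} (hT : MeasurePreserving T μ μ)
    {ε : ℝ} (s : Finset ι) (A : ι → Set α) (hA : ∀ i, MeasurableSet (A i))
    (hcov : ∀ᵐ x ∂μ, ∃ i ∈ s, x ∈ A i) (hsub : ∀ i, ∀ x ∈ A i, A i ⊆ Metric.ball x ε) :
    ∫⁻ x, (firstReturn T (Metric.ball x ε) x : ℝ≥0∞) ∂μ ≤ s.card := by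
  have hrestr : μ.restrict (⋃ i : s, A i) = μ := by
    refine Measure.restrict_eq_self_of_ae_mem ?_
    filter_upwards [hcov] with x ⟨i, hi, hx⟩
    exact mem_iUnion.2 ⟨⟨i, hi⟩, hx⟩
  calc ∫⁻ x, (firstReturn T (Metric.ball x ε) x : ℝ≥0∞) ∂μ
      = ∫⁻ x in ⋃ i : s, A i, (firstReturn T (Metric.ball x ε) x : ℝ≥0∞) ∂μ := by rw [hrestr]
    _ ≤ ∑' i : s, ∫⁻ x in A i, (firstReturn T (Metric.ball x ε) x : ℝ≥0∞) ∂μ :=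
        lintegral_iUnion_le _ _
    _ ≤ ∑' _ : s, 1 := by
        refine ENNReal.tsum_le_tsum fun i => ?_
        refine (setLIntegral_mono_ae' (hA i) ?_).trans (setLIntegral_firstReturn_le hT (hA i))
        filter_upwards [ae_exists_return hT (hA i)] with x hx hxA
        exact_mod_cast firstReturn_anti (hsub i x hxA) (hx hxA)
    _ = s.card := by simp

variable {n : ℕ}

lemma dist_lt_of_floor_eq {ε : ℝ} (hε : 0 < ε) {x y : Euc n}
    (h : ∀ i, ⌊x i / (ε / (n + 1))⌋ = ⌊y i / (ε / (n + 1))⌋) : dist x y < ε := by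
  have hn : (0 : ℝ) < n + 1 := by positivity
  set δ := ε / (n + 1) with hδ
  have hδ0 : 0 < δ := div_pos hε hn
  have hi : ∀ i, dist (x i) (y i) ^ 2 ≤ δ ^ 2 := fun i => by
    have := Int.abs_sub_lt_one_of_floor_eq_floor (h i)
    rw [← sub_div, abs_div, abs_of_pos hδ0, div_lt_one hδ0] at this
    rw [Real.dist_eq]
    gcongr
  rw [EuclideanSpace.dist_eq, Real.sqrt_lt' hε]
  calc ∑ i, dist (x i) (y i) ^ 2 ≤ ∑ _i : Fin n, δ ^ 2 := Finset.sum_le_sum fun i _ => hi i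
    _ = n * δ ^ 2 := by simp
    _ < (n + 1) ^ 2 * δ ^ 2 := by gcongr; nlinarith
    _ = ε ^ 2 := by rw [hδ]; field_simp

variable {T : Euc n → Euc n} {μ : Measure (Euc n)} [IsProbabilityMeasure μ]

lemma exists_lintegral_firstReturn_ball_le (hT : MeasurePreserving T μ μ) {X : Set (Euc n)}
    (hX : Bornology.IsBounded X) (hX1 : ∀ᵐ x ∂μ, x ∈ X) :
    ∃ C : ℝ, 1 ≤ C ∧ ∀ ε : ℝ, 0 < ε → ε < 1 →
      ∫⁻ x, (firstReturn T (Metric.ball x ε) x : ℝ≥0∞) ∂μ ≤ ENNReal.ofReal ((C / ε) ^ n) := by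
  obtain ⟨R, hR0, hR⟩ := hX.exists_pos_norm_le
  refine ⟨2 * R * (n + 1) + 2, by nlinarith [(Nat.cast_nonneg n : (0 : ℝ) ≤ n)],
    fun ε hε hε1 => ?_⟩
  set δ := ε / (n + 1) with hδ
  have hδ0 : 0 < δ := by positivity
  let s : Finset (Fin n → ℤ) := Fintype.piFinset fun _ => Finset.Icc ⌊-R / δ⌋ ⌊R / δ⌋
  let A : (Fin n → ℤ) → Set (Euc n) := fun j => {x | ∀ i, ⌊x i / δ⌋ = j i}
  have hA : ∀ j, MeasurableSet (A j) := fun j => by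
    have : A j = ⋂ i, {x : Euc n | ⌊x i / δ⌋ = j i} := by
      ext x
      simp [A]
    rw [this]
    refine MeasurableSet.iInter fun i => ?_
    have hm : Measurable fun x : Euc n => ⌊x i / δ⌋ := by fun_prop
    exact hm (measurableSet_singleton (j i))
  refine (lintegral_firstReturn_ball_le_card hT s A hA ?_ ?_).trans ?_
  · filter_upwards [hX1] with x hx
    refine ⟨fun i => ⌊x i / δ⌋, Fintype.mem_piFinset.2 fun i => Finset.mem_Icc.2 ?_, fun i => rfl⟩
    have := abs_le.1 ((PiLp.norm_apply_le x i).trans (hR x hx))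
    exact ⟨by gcongr; exact this.1, by gcongr; exact this.2⟩
  · intro j x hx y hy
    exact dist_lt_of_floor_eq hε fun i => (hy i).trans (hx i).symm
  · rw [← ENNReal.ofReal_natCast]
    refine ENNReal.ofReal_le_ofReal ?_
    simp only [s, Fintype.card_piFinset, Finset.prod_const, Finset.card_univ, Fintype.card_fin,
      Nat.cast_pow, Int.card_Icc]
    gcongr
    have hle : ⌊-R / δ⌋ ≤ ⌊R / δ⌋ := by gcongr; linarith
    have hcast : ((⌊R / δ⌋ + 1 - ⌊-R / δ⌋).toNat : ℝ) = ⌊R / δ⌋ + 1 - ⌊-R / δ⌋ := by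
      have : ((⌊R / δ⌋ + 1 - ⌊-R / δ⌋).toNat : ℤ) = ⌊R / δ⌋ + 1 - ⌊-R / δ⌋ :=
        Int.toNat_of_nonneg (by omega)
      exact_mod_cast this
    rw [hcast]
    have h1 := Int.floor_le (R / δ)
    have h2 := Int.lt_floor_add_one (-R / δ)
    have h3 : (2 * R * (n + 1) + 2) / ε = 2 * (R / δ) + 2 / ε := by rw [hδ]; field_simp
    have h4 : 2 ≤ 2 / ε := by rw [le_div_iff₀ hε]; linarith
    have h5 : -R / δ = -(R / δ) := neg_div _ _
    rw [h3]
    linarith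

lemma measurable_firstReturn_ball (hT : Measurable T) (ε : ℝ) :
    Measurable fun x => firstReturn T (Metric.ball x ε) x :=
  measurable_firstReturn fun k =>
    measurableSet_lt ((hT.iterate k).dist measurable_id) measurable_const

lemma ae_firstReturn_ball_pos (hT : MeasurePreserving T μ μ) {ε : ℝ} (hε : 0 < ε) :
    ∀ᵐ x ∂μ, 0 < firstReturn T (Metric.ball x ε) x := by
  filter_upwards [hT.conservative.ae_frequently_mem_of_mem_nhds] with x hx
  obtain ⟨k, hk, hmem⟩ := (frequently_atTop.1 (hx _ (Metric.ball_mem_nhds x hε))) 1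
  exact (firstReturn_spec ⟨k, hk, hmem⟩).1

end BallReturn

section Scale

lemma dimScale_eq_coe {F : ℝ → ℝ≥0∞} {q ε : ℝ} (h0 : F ε ≠ 0) (htop : F ε ≠ ⊤) :
    dimScale F q ε = ((Real.log (F ε).toReal / (1 - q) / -Real.log ε : ℝ) : EReal) := by
  rw [dimScale, elog, if_neg h0, if_neg htop, ← EReal.coe_mul, div_div,
    show (1 - q) * -Real.log ε = (q - 1) * Real.log ε by ring, mul_comm, div_eq_mul_inv]

lemma dimScale_eq_top {F : ℝ → ℝ≥0∞} {q ε : ℝ} (hq : q < 1) (hε : 0 < ε) (hε1 : ε < 1)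
    (htop : F ε = ⊤) : dimScale F q ε = ⊤ := by
  rw [dimScale, elog, if_neg (by simp [htop]), if_pos htop]
  refine EReal.coe_mul_top_of_pos (inv_pos.2 (mul_pos_of_neg_of_neg (by linarith) ?_))
  exact Real.log_neg hε hε1

/-- The scaling exponents whose upper and lower limits are the return time dimensions. -/
noncomputable def retScale {α : Type*} [MeasurableSpace α] [PseudoMetricSpace α] (T : α → α) (μ : Measure α)
    (q ε : ℝ) : EReal :=
  if q = 1 then ((retPFlog T μ ε / Real.log ε : ℝ) : EReal)
  else dimScale (fun ε => retPF T μ ε q) q ε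

variable {n : ℕ} {T : Euc n → Euc n} {μ : Measure (Euc n)} [IsProbabilityMeasure μ]

omit [IsProbabilityMeasure μ] in
lemma retPFlog_div_log (ε : ℝ) : retPFlog T μ ε / Real.log ε =
    (∫ x, Real.log (firstReturn T (Metric.ball x ε) x) ∂μ) / -Real.log ε := by
  simp_rw [retPFlog, Real.log_inv, integral_neg]
  rw [neg_div, div_neg]

variable {ε : ℝ}

lemma retScale_le_retScale_one (hT : MeasurePreserving T μ μ) (hε : 0 < ε) (hε1 : ε < 1)
    (hfin : ∫⁻ x, (firstReturn T (Metric.ball x ε) x : ℝ≥0∞) ∂μ ≠ ⊤) {q : ℝ} (hq : 1 < q) :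
    retScale T μ q ε ≤ retScale T μ 1 ε := by
  have hf := measurable_firstReturn_ball hT.measurable ε
  have hpos := ae_firstReturn_ball_pos hT hε
  have hL : 0 < -Real.log ε := neg_pos.2 (Real.log_neg hε hε1)
  have hp : 1 - q < 0 := by linarith
  have htop : retPF T μ ε q ≠ ⊤ :=
    ne_top_of_le_ne_top ENNReal.one_ne_top (lintegral_natCast_rpow_le_one hpos hp)
  have h := mul_integral_log_le hf hpos (integrable_log_natCast hf hfin) htop
  rw [retScale, retScale, if_neg hq.ne', if_pos rfl, retPFlog_div_log,
    dimScale_eq_coe (F := fun ε => retPF T μ ε q)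
      (lintegral_natCast_rpow_ne_zero hf hpos _) htop, EReal.coe_le_coe_iff]
  gcongr
  rwa [div_le_iff_of_neg hp, mul_comm]

lemma retScale_one_le_retScale (hT : MeasurePreserving T μ μ) (hε : 0 < ε) (hε1 : ε < 1)
    (hfin : ∫⁻ x, (firstReturn T (Metric.ball x ε) x : ℝ≥0∞) ∂μ ≠ ⊤) {q : ℝ} (hq : q < 1) :
    retScale T μ 1 ε ≤ retScale T μ q ε := by
  have hf := measurable_firstReturn_ball hT.measurable ε
  have hpos := ae_firstReturn_ball_pos hT hε
  have hL : 0 < -Real.log ε := neg_pos.2 (Real.log_neg hε hε1)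
  have hp : 0 < 1 - q := by linarith
  rw [retScale, retScale, if_neg hq.ne, if_pos rfl, retPFlog_div_log]
  by_cases htop : retPF T μ ε q = ⊤
  · rw [dimScale_eq_top hq hε hε1 htop]
    exact le_top
  have h := mul_integral_log_le hf hpos (integrable_log_natCast hf hfin) htop
  rw [dimScale_eq_coe (F := fun ε => retPF T μ ε q)
      (lintegral_natCast_rpow_ne_zero hf hpos _) htop, EReal.coe_le_coe_iff]
  gcongr
  rwa [le_div_iff₀ hp, mul_comm]

lemma retScale_anti_of_lt_one (hT : MeasurePreserving T μ μ) (hε : 0 < ε) (hε1 : ε < 1)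
    {q₁ q₂ : ℝ} (hq : q₁ ≤ q₂) (hq₂ : q₂ < 1) : retScale T μ q₂ ε ≤ retScale T μ q₁ ε := by
  have hf := measurable_firstReturn_ball hT.measurable ε
  have hpos := ae_firstReturn_ball_pos hT hε
  have hL : 0 < -Real.log ε := neg_pos.2 (Real.log_neg hε hε1)
  have hp₁ : 0 < 1 - q₁ := by linarith
  have hp₂ : 0 < 1 - q₂ := by linarith
  rw [retScale, retScale, if_neg hq₂.ne, if_neg (hq.trans_lt hq₂).ne]
  by_cases htop : retPF T μ ε q₁ = ⊤
  · rw [dimScale_eq_top (hq.trans_lt hq₂) hε hε1 htop]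
    exact le_top
  obtain ⟨htop₂, h⟩ := log_lintegral_rpow_le hf hpos hp₁.ne' (div_pos hp₂ hp₁)
    ((div_le_one hp₁).2 (by linarith)) htop
  rw [dimScale_eq_coe (F := fun ε => retPF T μ ε q₁)
      (lintegral_natCast_rpow_ne_zero hf hpos _) htop,
    dimScale_eq_coe (F := fun ε => retPF T μ ε q₂)
      (lintegral_natCast_rpow_ne_zero hf hpos _) htop₂, EReal.coe_le_coe_iff]
  refine div_le_div_of_nonneg_right ?_ hL.le
  rw [div_le_iff₀ hp₂]
  exact h.trans_eq (by unfold retPF; ring)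

lemma retScale_anti_of_one_lt (hT : MeasurePreserving T μ μ) (hε : 0 < ε) (hε1 : ε < 1)
    {q₁ q₂ : ℝ} (hq : q₁ ≤ q₂) (hq₁ : 1 < q₁) : retScale T μ q₂ ε ≤ retScale T μ q₁ ε := by
  have hf := measurable_firstReturn_ball hT.measurable ε
  have hpos := ae_firstReturn_ball_pos hT hε
  have hL : 0 < -Real.log ε := neg_pos.2 (Real.log_neg hε hε1)
  have hp₁ : 1 - q₁ < 0 := by linarith
  have hp₂ : 1 - q₂ < 0 := by linarith
  have htop : retPF T μ ε q₂ ≠ ⊤ :=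
    ne_top_of_le_ne_top ENNReal.one_ne_top (lintegral_natCast_rpow_le_one hpos hp₂)
  obtain ⟨htop₁, h⟩ := log_lintegral_rpow_le hf hpos hp₂.ne (div_pos_of_neg_of_neg hp₁ hp₂)
    ((div_le_one_of_neg hp₂).2 (by linarith)) htop
  rw [retScale, retScale, if_neg hq₁.ne', if_neg (hq₁.trans_le hq).ne',
    dimScale_eq_coe (F := fun ε => retPF T μ ε q₂)
      (lintegral_natCast_rpow_ne_zero hf hpos _) htop,
    dimScale_eq_coe (F := fun ε => retPF T μ ε q₁)
      (lintegral_natCast_rpow_ne_zero hf hpos _) htop₁, EReal.coe_le_coe_iff]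
  refine div_le_div_of_nonneg_right ?_ hL.le
  rw [le_div_iff_of_neg hp₁]
  exact h.trans_eq (by unfold retPF; ring)

lemma retScale_anti (hT : MeasurePreserving T μ μ) (hε : 0 < ε) (hε1 : ε < 1)
    (hfin : ∫⁻ x, (firstReturn T (Metric.ball x ε) x : ℝ≥0∞) ∂μ ≠ ⊤) {q₁ q₂ : ℝ}
    (hq : q₁ ≤ q₂) : retScale T μ q₂ ε ≤ retScale T μ q₁ ε := by
  rcases lt_trichotomy q₂ 1 with h₂ | rfl | h₂
  · exact retScale_anti_of_lt_one hT hε hε1 hq h₂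
  · rcases hq.eq_or_lt with rfl | h₁
    · exact le_rfl
    · exact retScale_one_le_retScale hT hε hε1 hfin h₁
  · rcases lt_trichotomy q₁ 1 with h₁ | rfl | h₁
    · exact (retScale_le_retScale_one hT hε hε1 hfin h₂).trans
        (retScale_one_le_retScale hT hε hε1 hfin h₁)
    · exact retScale_le_retScale_one hT hε hε1 hfin h₂
    · exact retScale_anti_of_one_lt hT hε hε1 hq h₁

lemma exists_retPFlog_div_log_mem_Icc (hT : MeasurePreserving T μ μ) {X : Set (Euc n)}
    (hX : Bornology.IsBounded X) (hX1 : ∀ᵐ x ∂μ, x ∈ X) :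
    ∃ K : ℝ, ∀ᶠ ε in 𝓝[>] (0 : ℝ), retPFlog T μ ε / Real.log ε ∈ Set.Icc 0 K := by
  obtain ⟨C, hC1, hC⟩ := exists_lintegral_firstReturn_ball_le hT hX hX1
  refine ⟨n * (Real.log C + 1), ?_⟩
  filter_upwards [Ioo_mem_nhdsGT (Real.exp_pos (-1))] with ε ⟨hε, hεe⟩
  have hlogε : Real.log ε < -1 := (Real.log_lt_iff_lt_exp hε).2 hεe
  have hL : 0 < -Real.log ε := by linarith
  have hε1 : ε < 1 := hεe.trans (by simp)
  have hbound := hC ε hε hε1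
  have hf := measurable_firstReturn_ball hT.measurable ε
  have hpos := ae_firstReturn_ball_pos hT hε
  have hfin := ne_top_of_le_ne_top ENNReal.ofReal_ne_top hbound
  have hmean := mul_integral_log_le (p := 1) hf hpos (integrable_log_natCast hf hfin)
    (by simpa using hfin)
  have hne := lintegral_natCast_rpow_ne_zero hf hpos 1
  simp only [ENNReal.rpow_one, one_mul] at hmean hne
  have hlog := Real.log_le_log (ENNReal.toReal_pos hne hfin)
    (ENNReal.toReal_le_of_le_ofReal (by positivity) hbound)
  rw [Real.log_pow, Real.log_div (by positivity) hε.ne'] at hlog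
  rw [retPFlog_div_log]
  refine ⟨div_nonneg (integral_nonneg fun x => Real.log_natCast_nonneg _) hL.le, ?_⟩
  rw [div_le_iff₀ hL]
  refine (hmean.trans hlog).trans ?_
  rw [mul_assoc]
  gcongr
  nlinarith [Real.log_nonneg hC1]

end Scale

section Dimensions

variable {n : ℕ} {T : Euc n → Euc n} {μ : Measure (Euc n)} {K : ℝ}

lemma DtauPlus_eq_limsup
    (hK : ∀ᶠ ε in 𝓝[>] (0 : ℝ), retPFlog T μ ε / Real.log ε ∈ Set.Icc 0 K) (q : ℝ) :
    DtauPlus T μ q = limsup (retScale T μ q) (𝓝[>] (0 : ℝ)) := by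
  unfold DtauPlus dimPlus
  split_ifs with h
  · have hbelow : IsBoundedUnder (· ≥ ·) (𝓝[>] (0 : ℝ)) fun ε => retPFlog T μ ε / Real.log ε :=
      isBoundedUnder_of_eventually_ge (hK.mono fun _ h => h.1)
    rw [EReal.coe_strictMono.monotone.map_limsup_of_continuousAt _
      continuous_coe_real_ereal.continuousAt
      (isBoundedUnder_of_eventually_le (hK.mono fun _ h => h.2)) hbelow.isCoboundedUnder_le]
    exact congrArg (fun u => limsup u _) (funext fun ε => by simp [retScale, h])
  · exact congrArg (fun u => limsup u _) (funext fun ε => by simp [retScale, h])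

lemma DtauMinus_eq_liminf
    (hK : ∀ᶠ ε in 𝓝[>] (0 : ℝ), retPFlog T μ ε / Real.log ε ∈ Set.Icc 0 K) (q : ℝ) :
    DtauMinus T μ q = liminf (retScale T μ q) (𝓝[>] (0 : ℝ)) := by
  unfold DtauMinus dimMinus
  split_ifs with h
  · have habove : IsBoundedUnder (· ≤ ·) (𝓝[>] (0 : ℝ)) fun ε => retPFlog T μ ε / Real.log ε :=
      isBoundedUnder_of_eventually_le (hK.mono fun _ h => h.2)
    rw [EReal.coe_strictMono.monotone.map_liminf_of_continuousAt _
      continuous_coe_real_ereal.continuousAt habove.isCoboundedUnder_ge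
      (isBoundedUnder_of_eventually_ge (hK.mono fun _ h => h.1))]
    exact congrArg (fun u => liminf u _) (funext fun ε => by simp [retScale, h])
  · exact congrArg (fun u => liminf u _) (funext fun ε => by simp [retScale, h])

end Dimensions

end ReturnTime

/-- For an ergodic dynamical system `(X, T, μ)`, the return time
generalized dimensions `D_τ^+(q)` and `D_τ^-(q)` are monotone non-increasing in `q`. -/
theorem return_time_dimensions_monotone {n : ℕ} (T : Euc n → Euc n)
    (μ : Measure (Euc n)) [IsProbabilityMeasure μ] (X : Set (Euc n))
    (hXc : IsCompact X) (hX1 : μ X = 1) (hTX : Set.MapsTo T X X)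
    (hErg : Ergodic T μ) :
    ∀ q₁ q₂ : ℝ, q₁ ≤ q₂ →
      DtauPlus T μ q₂ ≤ DtauPlus T μ q₁ ∧ DtauMinus T μ q₂ ≤ DtauMinus T μ q₁ := by
  have hT := hErg.toMeasurePreserving
  have hXae : ∀ᵐ x ∂μ, x ∈ X :=
    (prob_compl_eq_zero_iff hXc.measurableSet).2 hX1
  obtain ⟨K, hK⟩ := ReturnTime.exists_retPFlog_div_log_mem_Icc hT hXc.isBounded hXae
  obtain ⟨C, -, hC⟩ := ReturnTime.exists_lintegral_firstReturn_ball_le hT hXc.isBounded hXae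
  intro q₁ q₂ hq
  have hle : ReturnTime.retScale T μ q₂ ≤ᶠ[𝓝[>] (0 : ℝ)] ReturnTime.retScale T μ q₁ := by
    filter_upwards [Ioo_mem_nhdsGT one_pos] with ε ⟨hε, hε1⟩
    exact ReturnTime.retScale_anti hT hε hε1
      (ne_top_of_le_ne_top ENNReal.ofReal_ne_top (hC ε hε hε1)) hq
  rw [ReturnTime.DtauPlus_eq_limsup hK, ReturnTime.DtauPlus_eq_limsup hK,
    ReturnTime.DtauMinus_eq_liminf hK, ReturnTime.DtauMinus_eq_liminf hK]
  exact ⟨limsup_le_limsup hle, liminf_le_liminf hle⟩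
end

section
/- For every grid θ and every q ≠ 1, the scaling exponents of the enhanced box partition function Ψ_μ(θ,ε,q) coincide with the generalized measure dimensions: limsup_{ε→0} (1/(q-1))·log Ψ_μ(θ,ε,q)/log ε = D_μ^+(q) and liminf_{ε→0} (1/(q-1))·log Ψ_μ(θ,ε,q)/log ε = D_μ^-(q). In particular these values are independent of the grid θ. -/
open MeasureTheory Filter Set
open scoped ENNReal Topology NNReal

namespace Grid

variable {n : ℕ}

lemma measurableSet_box (θ : Grid n) (ε : ℝ) (j : Fin n → ℤ) : MeasurableSet (θ.box ε j) := by
  have hc (i : Fin n) : Continuous fun x => θ.coords x i := by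
    unfold coords
    fun_prop
  simp only [box, ofPred_forall, ofPred_and]
  exact MeasurableSet.iInter fun i =>
    (measurableSet_le measurable_const (hc i).measurable).inter
      (measurableSet_lt (hc i).measurable measurable_const)

lemma mem_box_iff_floor (θ : Grid n) {ε : ℝ} (hε : 0 < ε) (j : Fin n → ℤ) (x : Euc n) :
    x ∈ θ.box ε j ↔ (fun i => ⌊θ.coords x i / ε⌋) = j := by
  simp only [box, mem_ofPred_eq, funext_iff, Int.floor_eq_iff, le_div_iff₀ hε, div_lt_iff₀ hε]

lemma pairwise_disjoint_box (θ : Grid n) {ε : ℝ} (hε : 0 < ε) :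
    Pairwise (Function.onFun Disjoint (θ.box ε)) := fun i j hij =>
  Set.disjoint_left.2 fun x hi hj =>
    hij (((θ.mem_box_iff_floor hε i x).1 hi).symm.trans ((θ.mem_box_iff_floor hε j x).1 hj))

lemma iUnion_box (θ : Grid n) {ε : ℝ} (hε : 0 < ε) : ⋃ j, θ.box ε j = univ :=
  eq_univ_of_forall fun x => mem_iUnion.2 ⟨_, (θ.mem_box_iff_floor hε _ x).2 rfl⟩

lemma dist_eq_norm_coords (θ : Grid n) (x y : Euc n) :
    dist x y = ‖WithLp.toLp 2 (θ.coords x - θ.coords y)‖ := by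
  have h : WithLp.toLp 2 (θ.coords x - θ.coords y) = θ.rot.symm (x - y) := by
    ext i
    simp [coords]
  rw [h, LinearIsometryEquiv.norm_map, dist_eq_norm]

lemma ball_subset_bigBox (θ : Grid n) {ε : ℝ} {j : Fin n → ℤ} {x : Euc n}
    (hx : x ∈ θ.box ε j) : Metric.ball x ε ⊆ θ.bigBox ε j := by
  intro y hy i
  have h : |θ.coords y i - θ.coords x i| < ε := by
    refine lt_of_le_of_lt ?_ (Metric.mem_ball.1 hy)
    rw [θ.dist_eq_norm_coords]
    exact PiLp.norm_apply_le (WithLp.toLp 2 (θ.coords y - θ.coords x)) i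
  obtain ⟨h₁, h₂⟩ := abs_lt.1 h
  obtain ⟨h₃, h₄⟩ := hx i
  constructor <;> linarith

lemma bigBox_subset_ball (θ : Grid n) {ε : ℝ} (hε : 0 < ε) {j : Fin n → ℤ} {x : Euc n}
    (hx : x ∈ θ.box ε j) : θ.bigBox ε j ⊆ Metric.ball x ((2 * √n + 1) * ε) := by
  intro y hy
  have h (i : Fin n) : (θ.coords y i - θ.coords x i) ^ 2 ≤ (2 * ε) ^ 2 := by
    obtain ⟨h₁, h₂⟩ := hy i
    obtain ⟨h₃, h₄⟩ := hx i
    exact sq_le_sq' (by linarith) (by linarith)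
  rw [Metric.mem_ball, θ.dist_eq_norm_coords, EuclideanSpace.norm_eq]
  calc √(∑ i, ‖(WithLp.toLp 2 (θ.coords y - θ.coords x)) i‖ ^ 2)
      ≤ √(∑ _i : Fin n, (2 * ε) ^ 2) := by
        refine Real.sqrt_le_sqrt (Finset.sum_le_sum fun i _ => ?_)
        simpa using h i
    _ = 2 * √n * ε := by
        rw [Finset.sum_const, Finset.card_univ, Fintype.card_fin, nsmul_eq_mul,
          Real.sqrt_mul (Nat.cast_nonneg n), Real.sqrt_sq (by positivity)]
        ring
    _ < (2 * √n + 1) * ε := by linarith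

lemma lintegral_eq_tsum (θ : Grid n) (μ : Measure (Euc n)) {ε : ℝ} (hε : 0 < ε)
    (f : Euc n → ℝ≥0∞) : ∫⁻ x, f x ∂μ = ∑' j, ∫⁻ x in θ.box ε j, f x ∂μ := by
  rw [← lintegral_iUnion (θ.measurableSet_box ε) (θ.pairwise_disjoint_box hε), θ.iUnion_box hε,
    Measure.restrict_univ]

lemma lintegral_le_tsum (θ : Grid n) (μ : Measure (Euc n)) {ε : ℝ} (hε : 0 < ε)
    {f : Euc n → ℝ≥0∞} {g : (Fin n → ℤ) → ℝ≥0∞} (h : ∀ j, ∀ x ∈ θ.box ε j, f x ≤ g j) :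
    ∫⁻ x, f x ∂μ ≤ ∑' j, if μ (θ.box ε j) = 0 then 0 else μ (θ.box ε j) * g j := by
  rw [θ.lintegral_eq_tsum μ hε]
  refine ENNReal.tsum_le_tsum fun j => ?_
  split_ifs with h0
  · exact (setLIntegral_measure_zero _ _ h0).le
  · rw [mul_comm, ← setLIntegral_const]
    exact setLIntegral_mono' (θ.measurableSet_box ε j) (h j)

lemma tsum_le_lintegral (θ : Grid n) (μ : Measure (Euc n)) {ε : ℝ} (hε : 0 < ε)
    {f : Euc n → ℝ≥0∞} {g : (Fin n → ℤ) → ℝ≥0∞} (h : ∀ j, ∀ x ∈ θ.box ε j, g j ≤ f x) :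
    (∑' j, if μ (θ.box ε j) = 0 then 0 else μ (θ.box ε j) * g j) ≤ ∫⁻ x, f x ∂μ := by
  rw [θ.lintegral_eq_tsum μ hε]
  refine ENNReal.tsum_le_tsum fun j => ?_
  split_ifs with h0
  · exact zero_le
  · rw [mul_comm, ← setLIntegral_const]
    exact setLIntegral_mono' (θ.measurableSet_box ε j) (h j)

end Grid

lemma ENNReal.antitone_rpow_of_nonpos {z : ℝ} (hz : z ≤ 0) :
    Antitone fun x : ℝ≥0∞ => x ^ z := fun x y hxy => by
  have h := ENNReal.inv_le_inv.2 (ENNReal.rpow_le_rpow hxy (neg_nonneg.2 hz))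
  simpa only [← ENNReal.rpow_neg, neg_neg] using h

section Comparison

variable {n : ℕ} (μ : Measure (Euc n)) (θ : Grid n) {ε q : ℝ}

lemma measPF_le_psiMeasPF (hε : 0 < ε) (hq : 1 < q) : measPF μ ε q ≤ psiMeasPF μ θ ε q :=
  θ.lintegral_le_tsum μ hε fun _ _ hx =>
    ENNReal.rpow_le_rpow (measure_mono (θ.ball_subset_bigBox hx)) (by linarith)

lemma psiMeasPF_le_measPF (hε : 0 < ε) (hq : 1 < q) :
    psiMeasPF μ θ ε q ≤ measPF μ ((2 * √n + 1) * ε) q :=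
  θ.tsum_le_lintegral μ hε fun _ _ hx =>
    ENNReal.rpow_le_rpow (measure_mono (θ.bigBox_subset_ball hε hx)) (by linarith)

lemma psiMeasPF_le_measPF_of_lt_one (hε : 0 < ε) (hq : q < 1) :
    psiMeasPF μ θ ε q ≤ measPF μ ε q :=
  θ.tsum_le_lintegral μ hε fun _ _ hx =>
    ENNReal.antitone_rpow_of_nonpos (by linarith) (measure_mono (θ.ball_subset_bigBox hx))

lemma measPF_le_psiMeasPF_of_lt_one (hε : 0 < ε) (hq : q < 1) :
    measPF μ ((2 * √n + 1) * ε) q ≤ psiMeasPF μ θ ε q :=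
  θ.lintegral_le_tsum μ hε fun _ _ hx =>
    ENNReal.antitone_rpow_of_nonpos (by linarith) (measure_mono (θ.bigBox_subset_ball hε hx))

end Comparison

lemma elog_eq_log (x : ℝ≥0∞) : elog x = ENNReal.log x := by
  rw [elog, ENNReal.log]

lemma dimScale_le_dimScale {F G : ℝ → ℝ≥0∞} {q ε : ℝ} (hε : 0 < ε) (hε1 : ε < 1)
    (hgt : 1 < q → G ε ≤ F ε) (hlt : q < 1 → F ε ≤ G ε) :
    dimScale F q ε ≤ dimScale G q ε := by
  have hl := Real.log_neg hε hε1
  simp only [dimScale, elog_eq_log]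
  rcases lt_trichotomy q 1 with hq | rfl | hq
  · exact mul_le_mul_of_nonneg_left (ENNReal.log_monotone (hlt hq))
      (EReal.coe_nonneg.2 (inv_nonneg.2 (mul_nonneg_of_nonpos_of_nonpos (by linarith) hl.le)))
  · simp
  · rw [mul_comm, mul_comm _ (ENNReal.log (G ε))]
    exact EReal.mul_le_mul_of_nonpos_right (ENNReal.log_monotone (hgt hq))
      (EReal.coe_nonpos.2 (inv_nonpos.2 (mul_nonpos_of_nonneg_of_nonpos (by linarith) hl.le)))

lemma dimScale_measPF_nonneg {α : Type*} [MeasurableSpace α] [PseudoMetricSpace α]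
    (μ : Measure α) [IsProbabilityMeasure μ] {q ε : ℝ} (hε : 0 < ε) (hε1 : ε < 1) :
    0 ≤ dimScale (fun ε => measPF μ ε q) q ε := by
  have h1 : dimScale (fun _ => 1) q ε = 0 := by simp [dimScale, elog]
  rw [← h1]
  refine dimScale_le_dimScale hε hε1 (fun hq => ?_) (fun hq => ?_)
  · calc measPF μ ε q ≤ ∫⁻ _, 1 ∂μ :=
          lintegral_mono fun x => ENNReal.rpow_le_one prob_le_one (by linarith)
      _ = 1 := by simp
  · calc (1 : ℝ≥0∞) = ∫⁻ _, 1 ∂μ := by simp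
      _ ≤ measPF μ ε q := lintegral_mono fun x => by
          simpa using ENNReal.antitone_rpow_of_nonpos (z := q - 1) (by linarith)
            (prob_le_one (μ := μ) (s := Metric.ball x ε))

lemma map_const_mul_nhdsGT_zero {c : ℝ} (hc : 0 < c) :
    map (fun ε => c * ε) (𝓝[>] (0:ℝ)) = 𝓝[>] 0 := by
  have h := (Homeomorph.mulLeft₀ c hc.ne').isEmbedding.map_nhdsWithin_eq (Ioi 0) 0
  simpa [Set.image_mul_left_Ioi hc] using h

lemma tendsto_log_const_mul_div_log {c : ℝ} (hc : 0 < c) :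
    Tendsto (fun ε => Real.log (c * ε) / Real.log ε) (𝓝[>] 0) (𝓝 1) := by
  have h : Tendsto (fun ε => Real.log c / Real.log ε + 1) (𝓝[>] 0) (𝓝 (0 + 1)) :=
    (Real.tendsto_log_nhdsGT_zero.const_div_atBot (Real.log c)).add_const 1
  rw [zero_add] at h
  refine h.congr' ?_
  filter_upwards [Ioo_mem_nhdsGT (zero_lt_one' ℝ)] with ε ⟨hε, hε1⟩
  rw [Real.log_mul hc.ne' hε.ne', add_div, div_self (Real.log_neg hε hε1).ne]

lemma dimScale_comp_const_mul (F : ℝ → ℝ≥0∞) (q c : ℝ) {ε : ℝ} (h : Real.log (c * ε) ≠ 0) :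
    dimScale (fun ε => F (c * ε)) q ε =
      dimScale F q (c * ε) * ((Real.log (c * ε) / Real.log ε : ℝ) : EReal) := by
  rw [dimScale, dimScale, mul_right_comm, ← EReal.coe_mul]
  congr 2
  rw [mul_inv, mul_inv, mul_assoc, ← mul_div_assoc, inv_mul_cancel₀ h, one_div]

/-- Rescaling the argument of a partition function does not decrease its scaling exponents. -/
lemma le_limsup_liminf_dimScale_comp_const_mul {F : ℝ → ℝ≥0∞} {q c : ℝ} (hc : 0 < c)
    (hF : ∀ᶠ ε in 𝓝[>] 0, 0 ≤ dimScale F q ε) :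
    limsup (dimScale F q) (𝓝[>] 0) ≤ limsup (dimScale (fun ε => F (c * ε)) q) (𝓝[>] 0) ∧
      liminf (dimScale F q) (𝓝[>] 0) ≤
        liminf (dimScale (fun ε => F (c * ε)) q) (𝓝[>] 0) := by
  set v : ℝ → EReal := fun ε => ((Real.log (c * ε) / Real.log ε : ℝ) : EReal)
  set u : ℝ → EReal := fun ε => dimScale F q (c * ε)
  have hmap := map_const_mul_nhdsGT_zero hc
  have hsmall : ∀ᶠ ε in 𝓝[>] (0:ℝ), ε ∈ Ioo 0 1 := Ioo_mem_nhdsGT zero_lt_one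
  have heq : dimScale (fun ε => F (c * ε)) q =ᶠ[𝓝[>] 0] u * v := by
    have : ∀ᶠ ε in 𝓝[>] (0:ℝ), c * ε ∈ Ioo 0 1 := by
      rw [← hmap, eventually_map] at hsmall
      exact hsmall
    filter_upwards [this] with ε ⟨h0, h1⟩
    exact dimScale_comp_const_mul F q c (Real.log_neg h0 h1).ne
  have hu : 0 ≤ᶠ[𝓝[>] 0] u := by
    rw [← hmap, eventually_map] at hF
    exact hF
  have hv1 : Tendsto v (𝓝[>] 0) (𝓝 1) :=
    (continuous_coe_real_ereal.tendsto 1).comp (tendsto_log_const_mul_div_log hc)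
  have hv : 0 ≤ᶠ[𝓝[>] 0] v :=
    (hv1.eventually (lt_mem_nhds zero_lt_one)).mono fun _ h => h.le
  have hsup : limsup (dimScale F q) (𝓝[>] 0) = limsup u (𝓝[>] 0) := by
    conv_lhs => rw [← hmap]
    rfl
  have hinf : liminf (dimScale F q) (𝓝[>] 0) = liminf u (𝓝[>] 0) := by
    conv_lhs => rw [← hmap]
    rfl
  rw [limsup_congr heq, liminf_congr heq, hsup, hinf]
  constructor
  · simpa only [hv1.liminf_eq, mul_one] using EReal.le_limsup_mul hu.frequently hv
  · simpa only [hv1.liminf_eq, mul_one] using EReal.le_liminf_mul hu hv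

/-- For every grid `θ` and every `q ≠ 1`, the scaling exponents of the
enhanced box partition function `Ψ_μ(θ,ε,q)` coincide with the generalized measure
dimensions `D_μ^±(q)`; in particular they are independent of the grid. -/
theorem psi_measure_box_dimensions_eq_generalized {n : ℕ} (μ : Measure (Euc n))
    [IsProbabilityMeasure μ] (X : Set (Euc n)) (hXc : IsCompact X) (hX1 : μ X = 1) :
    ∀ (θ : Grid n) (q : ℝ), q ≠ 1 →
      Filter.limsup (dimScale (fun ε => psiMeasPF μ θ ε q) q) (𝓝[>] (0:ℝ)) =
          DmuPlus μ q ∧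
        Filter.liminf (dimScale (fun ε => psiMeasPF μ θ ε q) q) (𝓝[>] (0:ℝ)) =
          DmuMinus μ q := by
  intro θ q hq
  have hc : (0:ℝ) < 2 * √n + 1 := by positivity
  have hsmall : ∀ᶠ ε in 𝓝[>] (0:ℝ), ε ∈ Ioo 0 1 := Ioo_mem_nhdsGT zero_lt_one
  have hupper : dimScale (fun ε => psiMeasPF μ θ ε q) q ≤ᶠ[𝓝[>] 0]
      dimScale (fun ε => measPF μ ε q) q := by
    filter_upwards [hsmall] with ε ⟨hε, hε1⟩
    exact dimScale_le_dimScale hε hε1 (measPF_le_psiMeasPF μ θ hε)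
      (psiMeasPF_le_measPF_of_lt_one μ θ hε)
  have hlower : dimScale (fun ε => measPF μ ((2 * √n + 1) * ε) q) q ≤ᶠ[𝓝[>] 0]
      dimScale (fun ε => psiMeasPF μ θ ε q) q := by
    filter_upwards [hsmall] with ε ⟨hε, hε1⟩
    exact dimScale_le_dimScale hε hε1 (psiMeasPF_le_measPF μ θ hε)
      (measPF_le_psiMeasPF_of_lt_one μ θ hε)
  obtain ⟨hsup, hinf⟩ := le_limsup_liminf_dimScale_comp_const_mul
    (F := fun ε => measPF μ ε q) (q := q) hc
    (hsmall.mono fun ε hε => dimScale_measPF_nonneg μ hε.1 hε.2)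
  rw [DmuPlus, DmuMinus, dimPlus, dimMinus, if_neg hq, if_neg hq]
  exact ⟨(limsup_le_limsup hupper).antisymm (hsup.trans (limsup_le_limsup hlower)),
    (liminf_le_liminf hupper).antisymm (hinf.trans (liminf_le_liminf hlower))⟩
end

section
/- Let k be a constant depending only on the Euclidean dimension n such that Ā_j ⊆ B_{kε}(x) whenever x ∈ A_j. For every grid θ of side ε and every ε > 0 the following inequalities hold: if q ≥ 1 then Γ_μ(ε,q) ≤ Ψ_μ(θ,ε,q) ≤ Φ_μ(θ,ε,q) and Γ_μ(kε,q) ≥ Ψ_μ(θ,ε,q); if q ≤ 1 then Γ_μ(ε,q) ≥ Ψ_μ(θ,ε,q), Ψ_μ(θ,ε,q) ≤ Φ_μ(θ,ε,q), and Γ_μ(kε,q) ≤ Ψ_μ(θ,ε,q). -/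
open MeasureTheory Filter Set
open scoped ENNReal Topology NNReal

lemma Grid.continuous_coords {n : ℕ} (θ : Grid n) (i : Fin n) :
    Continuous fun x => θ.coords x i := by
  unfold Grid.coords
  fun_prop

lemma Grid.measurableSet_box_s3 {n : ℕ} (θ : Grid n) (ε : ℝ) (j : Fin n → ℤ) :
    MeasurableSet (θ.box ε j) := by
  simp only [Grid.box, ofPred_forall]
  exact MeasurableSet.iInter fun i =>
    (measurableSet_le measurable_const (θ.continuous_coords i).measurable).inter
      (measurableSet_lt (θ.continuous_coords i).measurable measurable_const)

lemma Grid.mem_box_iff_floor_s3 {n : ℕ} (θ : Grid n) {ε : ℝ} (hε : 0 < ε) (j : Fin n → ℤ)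
    (x : Euc n) : x ∈ θ.box ε j ↔ (fun i => ⌊θ.coords x i / ε⌋) = j := by
  simp only [Grid.box, mem_ofPred_eq, funext_iff, Int.floor_eq_iff, le_div_iff₀ hε,
    div_lt_iff₀ hε]

lemma Grid.iUnion_box_s3 {n : ℕ} (θ : Grid n) {ε : ℝ} (hε : 0 < ε) :
    ⋃ j, θ.box ε j = univ :=
  eq_univ_of_forall fun x => mem_iUnion.2 ⟨_, (θ.mem_box_iff_floor_s3 hε _ x).2 rfl⟩

lemma Grid.pairwise_disjoint_box_s3 {n : ℕ} (θ : Grid n) {ε : ℝ} (hε : 0 < ε) :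
    Pairwise (Function.onFun Disjoint (θ.box ε)) := fun i j hij =>
  disjoint_left.2 fun x hi hj => hij <|
    ((θ.mem_box_iff_floor_s3 hε i x).1 hi).symm.trans ((θ.mem_box_iff_floor_s3 hε j x).1 hj)

lemma Grid.abs_coords_sub_le {n : ℕ} (θ : Grid n) (x y : Euc n) (i : Fin n) :
    |θ.coords y i - θ.coords x i| ≤ dist y x := by
  have h : θ.coords y i - θ.coords x i = θ.rot.symm (y - x) i := by
    rw [← sub_sub_sub_cancel_right y x θ.origin, map_sub]
    rfl
  rw [h, ← Real.norm_eq_abs, dist_eq_norm, ← θ.rot.symm.norm_map (y - x)]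
  exact PiLp.norm_apply_le _ i

lemma Grid.ball_subset_bigBox_s3 {n : ℕ} (θ : Grid n) {ε : ℝ} {j : Fin n → ℤ} {x : Euc n}
    (hx : x ∈ θ.box ε j) : Metric.ball x ε ⊆ θ.bigBox ε j := fun y hy i => by
  have h := abs_lt.1 ((θ.abs_coords_sub_le x y i).trans_lt (Metric.mem_ball.1 hy))
  have hxi := hx i
  constructor <;> linarith [h.1, h.2, hxi.1, hxi.2]

lemma Grid.box_subset_bigBox {n : ℕ} (θ : Grid n) {ε : ℝ} (hε : 0 < ε) (j : Fin n → ℤ) :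
    θ.box ε j ⊆ θ.bigBox ε j := fun _ hx =>
  θ.ball_subset_bigBox_s3 hx (Metric.mem_ball_self hε)

lemma ENNReal.rpow_le_rpow_of_nonpos {a b : ℝ≥0∞} (h : a ≤ b) {p : ℝ} (hp : p ≤ 0) :
    b ^ p ≤ a ^ p := by
  rw [← neg_neg p, ENNReal.rpow_neg b, ENNReal.rpow_neg a]
  exact ENNReal.inv_le_inv.2 (ENNReal.rpow_le_rpow h (neg_nonneg.2 hp))

lemma measPF_eq_tsum {n : ℕ} (μ : Measure (Euc n)) (θ : Grid n) {ε : ℝ} (hε : 0 < ε)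
    (r q : ℝ) :
    measPF μ r q = ∑' j, ∫⁻ x in θ.box ε j, μ (Metric.ball x r) ^ (q - 1) ∂μ := by
  rw [measPF, ← lintegral_iUnion (θ.measurableSet_box_s3 ε) (θ.pairwise_disjoint_box_s3 hε),
    θ.iUnion_box_s3 hε, Measure.restrict_univ]

lemma psiMeasPF_eq_tsum {n : ℕ} (μ : Measure (Euc n)) (θ : Grid n) (ε q : ℝ) :
    psiMeasPF μ θ ε q = ∑' j, ∫⁻ _ in θ.box ε j, μ (θ.bigBox ε j) ^ (q - 1) ∂μ := by
  refine tsum_congr fun j => ?_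
  rw [setLIntegral_const, mul_comm]
  split_ifs with h <;> simp [h]

lemma measPF_le_psiMeasPF_s3 {n : ℕ} (μ : Measure (Euc n)) (θ : Grid n) {ε : ℝ} (hε : 0 < ε)
    {r q : ℝ} (h : ∀ j, ∀ x ∈ θ.box ε j,
      μ (Metric.ball x r) ^ (q - 1) ≤ μ (θ.bigBox ε j) ^ (q - 1)) :
    measPF μ r q ≤ psiMeasPF μ θ ε q := by
  rw [measPF_eq_tsum μ θ hε, psiMeasPF_eq_tsum]
  exact ENNReal.tsum_le_tsum fun j => setLIntegral_mono' (θ.measurableSet_box_s3 ε j) (h j)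

lemma psiMeasPF_le_measPF_s3 {n : ℕ} (μ : Measure (Euc n)) (θ : Grid n) {ε : ℝ} (hε : 0 < ε)
    {r q : ℝ} (h : ∀ j, ∀ x ∈ θ.box ε j,
      μ (θ.bigBox ε j) ^ (q - 1) ≤ μ (Metric.ball x r) ^ (q - 1)) :
    psiMeasPF μ θ ε q ≤ measPF μ r q := by
  rw [measPF_eq_tsum μ θ hε, psiMeasPF_eq_tsum]
  exact ENNReal.tsum_le_tsum fun j => setLIntegral_mono' (θ.measurableSet_box_s3 ε j) (h j)

lemma psiMeasPF_le_riediPF {n : ℕ} (μ : Measure (Euc n)) [IsFiniteMeasure μ] (θ : Grid n)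
    {ε : ℝ} (hε : 0 < ε) (q : ℝ) : psiMeasPF μ θ ε q ≤ riediPF μ θ ε q := by
  refine ENNReal.tsum_le_tsum fun j => ?_
  split_ifs with h
  · exact le_rfl
  have hle : μ (θ.box ε j) ≤ μ (θ.bigBox ε j) := measure_mono (θ.box_subset_bigBox hε j)
  have hpos : μ (θ.bigBox ε j) ≠ 0 := fun h0 => h (le_zero_iff.1 (hle.trans_eq h0))
  calc μ (θ.box ε j) * μ (θ.bigBox ε j) ^ (q - 1)
      ≤ μ (θ.bigBox ε j) ^ (1 : ℝ) * μ (θ.bigBox ε j) ^ (q - 1) := by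
        rw [ENNReal.rpow_one]
        gcongr
    _ = μ (θ.bigBox ε j) ^ q := by
        rw [← ENNReal.rpow_add _ _ hpos (measure_ne_top _ _), add_sub_cancel]

/-- Inequalities between the partition functions `Γ_μ`, `Ψ_μ`, `Φ_μ`,
where `k` is a dimension-dependent constant such that `Ā_j ⊆ B_{kε}(x)` whenever `x ∈ A_j`. -/
theorem measure_partition_function_inequalities {n : ℕ} (μ : Measure (Euc n))
    [IsProbabilityMeasure μ] (X : Set (Euc n)) (hXc : IsCompact X) (hX1 : μ X = 1)
    (k : ℝ)
    (hk : ∀ (θ : Grid n) (ε : ℝ), 0 < ε → ∀ (j : Fin n → ℤ) (x : Euc n),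
      x ∈ θ.box ε j → θ.bigBox ε j ⊆ Metric.ball x (k * ε)) :
    ∀ (θ : Grid n) (ε : ℝ), 0 < ε → ∀ q : ℝ,
      (1 ≤ q →
        measPF μ ε q ≤ psiMeasPF μ θ ε q ∧
          psiMeasPF μ θ ε q ≤ riediPF μ θ ε q ∧
          psiMeasPF μ θ ε q ≤ measPF μ (k * ε) q) ∧
      (q ≤ 1 →
        psiMeasPF μ θ ε q ≤ measPF μ ε q ∧
          psiMeasPF μ θ ε q ≤ riediPF μ θ ε q ∧
          measPF μ (k * ε) q ≤ psiMeasPF μ θ ε q) := by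
  intro θ ε hε q
  have hball : ∀ j, ∀ x ∈ θ.box ε j, μ (Metric.ball x ε) ≤ μ (θ.bigBox ε j) :=
    fun j x hx => measure_mono (θ.ball_subset_bigBox_s3 hx)
  have hbig : ∀ j, ∀ x ∈ θ.box ε j, μ (θ.bigBox ε j) ≤ μ (Metric.ball x (k * ε)) :=
    fun j x hx => measure_mono (hk θ ε hε j x hx)
  refine ⟨fun hq => ?_, fun hq => ?_⟩
  · have hq' : 0 ≤ q - 1 := sub_nonneg.2 hq
    exact ⟨measPF_le_psiMeasPF_s3 μ θ hε fun j x hx => ENNReal.rpow_le_rpow (hball j x hx) hq',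
      psiMeasPF_le_riediPF μ θ hε q,
      psiMeasPF_le_measPF_s3 μ θ hε fun j x hx => ENNReal.rpow_le_rpow (hbig j x hx) hq'⟩
  · have hq' : q - 1 ≤ 0 := sub_nonpos.2 hq
    exact ⟨psiMeasPF_le_measPF_s3 μ θ hε fun j x hx =>
        ENNReal.rpow_le_rpow_of_nonpos (hball j x hx) hq',
      psiMeasPF_le_riediPF μ θ hε q,
      measPF_le_psiMeasPF_s3 μ θ hε fun j x hx =>
        ENNReal.rpow_le_rpow_of_nonpos (hbig j x hx) hq'⟩
end
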